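/- arXiv:2010.12903 — 2 statements merged into one kernel-verified Lean document; each statement's English description precedes it below -/
import Mathlib

section
/- Let R be a unital ring (not necessarily commutative), n ≥ 2, and let a₁, …, a_n be units of R with ordered product a₁a₂···a_n = 1. Let A ∈ M_n(R) be the diagonal matrix with diagonal entries a₁, …, a_n; let C ∈ M_n(R) be the diagonal matrix with c₁₁ = 1 and c_{ii} = a₁a₂···a_{i−1} for 2 ≤ i ≤ n; and let P ∈ M_n(R) be the permutation matrix of the cycle (1 2 … n), i.e., P e_i = e_{i+1} for 1 ≤ i ≤ n−1 and P e_n = e₁, where e₁, …, e_n is the standard basis of Rⁿ. Then C and P are invertible and A = C⁻¹ P⁻¹ C P; in particular, every such diagonal matrix is a multiplicative commutator in GL_n(R). -/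
/-- Over any unital ring `R`: if `a₁, …, aₙ` are units with ordered product
`a₁a₂⋯aₙ = 1`, `A = diag(a₁,…,aₙ)`, `C = diag(1, a₁, a₁a₂, …, a₁⋯a_{n−1})` and `P` is the
permutation matrix of the cycle `(1 2 … n)` (so `P eᵢ = e_{i+1 mod n}`), then `C` and `P`
are invertible and `A = C⁻¹ P⁻¹ C P`; in particular every such diagonal matrix is a
multiplicative commutator in `GL_n(R)`. -/
theorem diagonal_eq_commutator
    {R : Type*} [Ring R] (n : ℕ) (hn : 2 ≤ n) (a : Fin n → Rˣ)
    (hprod : (List.ofFn fun i => (a i : R)).prod = 1)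
    (C P : Matrix (Fin n) (Fin n) R)
    (hC : C = Matrix.diagonal fun i : Fin n =>
      (((List.finRange n).take i.val).map fun j => (a j : R)).prod)
    (hP : P = Matrix.of fun i j : Fin n =>
      if (i : ℕ) = ((j : ℕ) + 1) % n then (1 : R) else 0) :
    IsUnit C ∧ IsUnit P ∧
      Matrix.diagonal (fun i => (a i : R)) =
        Ring.inverse C * Ring.inverse P * C * P := by
  have : NeZero n := ⟨by omega⟩
  have hCu : IsUnit C := by
    have hu : IsUnit fun i : Fin n =>
        (((List.finRange n).take i.val).map fun j => (a j : R)).prod := by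
      refine Pi.isUnit_iff.mpr fun i => ⟨(((List.finRange n).take i.val).map a).prod, ?_⟩
      simpa [List.map_map, Function.comp_def] using
        map_list_prod (Units.coeHom R) (((List.finRange n).take i.val).map a)
    rw [hC]
    exact hu.map (Matrix.diagonalRingHom (Fin n) R)
  have hPu : IsUnit P := by
    have hPσ : P = Matrix.permMatrixHom (R := R) (Equiv.addRight (1 : Fin n)) := by
      ext i j
      simp only [hP, Matrix.of_apply, Matrix.permMatrixHom_apply, PEquiv.toMatrix_apply,
        Equiv.toPEquiv_apply, Option.mem_some_iff, Equiv.Perm.inv_def, Equiv.symm_apply_eq,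
        Equiv.coe_addRight, Fin.ext_iff, Fin.val_add, Fin.val_one', Nat.add_mod_mod]
    rw [hPσ]
    exact (Group.isUnit _).map Matrix.permMatrixHom
  refine ⟨hCu, hPu, ?_⟩
  have hcomm : P * (C * Matrix.diagonal fun i => (a i : R)) = C * P := by
    rw [hC, Matrix.diagonal_mul_diagonal]
    ext i j
    rw [Matrix.mul_diagonal, Matrix.diagonal_mul, hP, Matrix.of_apply]
    split_ifs with hij
    · have hj := List.prod_take_succ ((List.finRange n).map fun j => (a j : R)) j (by simp)
      simp only [List.map_take, List.getElem_map, List.getElem_finRange, Fin.cast_mk,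
        Fin.eta] at hj ⊢
      rw [one_mul, mul_one, ← hj, hij]
      rcases Nat.lt_or_ge ((j : ℕ) + 1) n with h | h
      · rw [Nat.mod_eq_of_lt h]
      · have hn' : (j : ℕ) + 1 = n := by omega
        rw [hn', Nat.mod_self, List.take_of_length_le (by simp), ← List.ofFn_eq_map, hprod]
        simp
    · simp
  rw [mul_assoc _ C P, ← hcomm, mul_assoc, Ring.inverse_mul_cancel_left _ _ hPu,
    Ring.inverse_mul_cancel_left _ _ hCu]
end

section
/- Let 𝒜 be a commutative unital complex Banach algebra whose maximal ideal space 𝔐(𝒜) is totally disconnected, and let A ∈ GL_n(𝒜). Then there exist finitely many idempotents e₁, …, e_k ∈ 𝒜 with e₁ + ⋯ + e_k = 1 and e_i e_j = 0 for all i ≠ j, such that for every i the matrix A_i := e_i·(A − I_n) + I_n is invertible and 0 lies in the unbounded connected component of ℂ \ σ(A_i), where σ(A_i) is the spectrum of A_i in the complex Banach algebra M_n(𝒜). -/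
section IdempotentPartition

open WeakDual Filter Topology

theorem norm_choose_neg_half_le_one (n : ℕ) : ‖Ring.choose (-1 / 2 : ℂ) n‖ ≤ 1 := by
  induction n with
  | zero => simp
  | succ n ih =>
    have h := Ring.choose_smul_choose (-1 / 2 : ℂ) (Nat.le_succ n)
    rw [Nat.succ_eq_add_one, Nat.choose_succ_self_right, Nat.add_sub_cancel_left,
      Ring.choose_one_right, nsmul_eq_mul] at h
    have h1 : ‖(-1 / 2 : ℂ) - n‖ ≤ n + 1 := by
      calc ‖(-1 / 2 : ℂ) - n‖ ≤ ‖(-1 / 2 : ℂ)‖ + ‖(n : ℂ)‖ := norm_sub_le _ _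
        _ ≤ n + 1 := by rw [Complex.norm_natCast]; norm_num; linarith
    have h2 := congrArg norm h
    rw [norm_mul, norm_mul, Complex.norm_natCast] at h2
    push_cast at h2
    have hn : (0 : ℝ) < n + 1 := by positivity
    refine le_of_mul_le_mul_left (a := (n : ℝ) + 1) ?_ hn
    rw [h2, mul_one]
    calc _ ≤ 1 * ((n : ℝ) + 1) := by gcongr
      _ = _ := one_mul _

theorem sum_antidiagonal_choose_neg_half (n : ℕ) :
    ∑ ij ∈ Finset.HasAntidiagonal.antidiagonal n,
      Ring.choose (-1 / 2 : ℂ) ij.1 * Ring.choose (-1 / 2 : ℂ) ij.2 = (-1) ^ n := by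
  rw [← Ring.add_choose_eq n (Commute.all _ _)]
  have : (-1 / 2 : ℂ) + -1 / 2 = -1 := by norm_num
  rw [this, Ring.choose_neg, add_sub_cancel_left, Ring.choose_natCast, Nat.choose_self]
  rcases Nat.even_or_odd n with h | h
  · rw [Int.negOnePow_even _ (by exact_mod_cast h), h.neg_one_pow]; simp
  · rw [Int.negOnePow_odd _ (by exact_mod_cast h), h.neg_one_pow]; simp

/-- The `m`-th partial sum of the expansion of the idempotent
`1 / 2 + (b - 1 / 2) * (1 + 4 * (b ^ 2 - b)) ^ (- 1 / 2)` attached to an almost idempotent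
element `b`. -/
noncomputable def idempotentApprox {A : Type*} [CommRing A] [Algebra ℂ A] (b : A) (m : ℕ) : A :=
  algebraMap ℂ A (1 / 2) + (b - algebraMap ℂ A (1 / 2)) *
    ∑ n ∈ Finset.range m, Ring.choose (-1 / 2 : ℂ) n • (4 * (b ^ 2 - b)) ^ n

theorem map_idempotentApprox {A B : Type*} [CommRing A] [Algebra ℂ A] [CommRing B] [Algebra ℂ B]
    (f : A →ₐ[ℂ] B) (b : A) (m : ℕ) :
    f (idempotentApprox b m) = idempotentApprox (f b) m := by
  simp only [idempotentApprox, map_add, map_mul, map_sub, map_sum, map_smul, map_pow,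
    AlgHom.commutes, map_ofNat]

section Banach

variable {A : Type*} [NormedCommRing A] [NormedAlgebra ℂ A] [CompleteSpace A]

theorem exists_isIdempotentElem_near {b : A} {C : ℝ}
    (hb : ∀ n, ‖(b ^ 2 - b) ^ n‖ ≤ C * (1 / 16) ^ n) :
    ∃ e : A, IsIdempotentElem e ∧
      (∀ m, ‖e - idempotentApprox b m‖ ≤
        ‖b - algebraMap ℂ A (1 / 2)‖ * (2 * C * (1 / 4) ^ m)) ∧
      ∀ φ : characterSpace ℂ A, (‖φ b‖ ≤ 1 / 32 → φ e = 0) ∧ (‖φ b - 1‖ ≤ 1 / 32 → φ e = 1) := by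
  set s : A := 4 * (b ^ 2 - b) with hs
  set t : ℕ → A := fun n => Ring.choose (-1 / 2 : ℂ) n • s ^ n with ht
  have hsn : ∀ n, ‖s ^ n‖ ≤ C * (1 / 4) ^ n := fun n => by
    have : s ^ n = (4 : ℂ) ^ n • (b ^ 2 - b) ^ n := by
      rw [hs, mul_pow, Algebra.smul_def, map_pow, map_ofNat]
    rw [this, norm_smul, norm_pow]
    calc _ ≤ ‖(4 : ℂ)‖ ^ n * (C * (1 / 16) ^ n) := by gcongr; exact hb n
      _ = C * (1 / 4) ^ n := by
        rw [mul_left_comm, ← mul_pow]; norm_num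
  have htn : ∀ n, ‖t n‖ ≤ C * (1 / 4) ^ n := fun n => by
    rw [ht, norm_smul]
    calc _ ≤ 1 * ‖s ^ n‖ := by gcongr; exact norm_choose_neg_half_le_one n
      _ ≤ _ := by rw [one_mul]; exact hsn n
  have hgeo : Summable fun n : ℕ => C * (1 / 4 : ℝ) ^ n :=
    (summable_geometric_of_lt_one (by norm_num) (by norm_num)).mul_left C
  have htsn : Summable fun n => ‖t n‖ := .of_nonneg_of_le (fun _ => norm_nonneg _) htn hgeo
  have hts : Summable t := htsn.of_norm
  have hss : Summable fun n => (-s) ^ n := by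
    refine Summable.of_norm (.of_nonneg_of_le (fun _ => norm_nonneg _) (fun n => ?_) hgeo)
    rw [neg_pow]
    rcases neg_one_pow_eq_or A n with h | h <;> simpa [h] using! hsn n
  set T : A := ∑' n, t n with hT
  have hTT : T * T = ∑' n, (-s) ^ n := by
    rw [hT, tsum_mul_tsum_eq_tsum_sum_antidiagonal_of_summable_norm htsn htsn]
    refine tsum_congr fun n => ?_
    rw [neg_pow, ← map_one (algebraMap ℂ A), ← map_neg, ← map_pow, ← Algebra.smul_def,
      ← sum_antidiagonal_choose_neg_half, Finset.sum_smul]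
    refine Finset.sum_congr rfl fun ij hij => ?_
    rw [ht, smul_mul_smul_comm, ← pow_add, Finset.HasAntidiagonal.mem_antidiagonal.mp hij]
  have hTs : T * T * (1 + s) = 1 := by
    have := hss.tsum_pow_mul_one_sub
    rwa [sub_neg_eq_add, ← hTT] at this
  have half : algebraMap ℂ A (1 / 2) * 2 = 1 := by
    rw [← map_ofNat (algebraMap ℂ A) 2, ← map_mul]; norm_num
  have hidem : IsIdempotentElem (algebraMap ℂ A (1 / 2) + (b - algebraMap ℂ A (1 / 2)) * T) := by
    rw [IsIdempotentElem]
    set h := algebraMap ℂ A (1 / 2)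
    have hh : h * h * 4 = 1 := by linear_combination (h * 2 + 1) * half
    rw [hs] at hTs
    have key : (b - h) ^ 2 = h * h * (1 + 4 * (b ^ 2 - b)) := by
      linear_combination (-b) * half - (b ^ 2 - b) * hh
    linear_combination T ^ 2 * key + h * h * hTs + ((b - h) * T + h) * half
  refine ⟨_, hidem, fun m => ?_, fun φ => ?_⟩
  · have : algebraMap ℂ A (1 / 2) + (b - algebraMap ℂ A (1 / 2)) * T - idempotentApprox b m
        = (b - algebraMap ℂ A (1 / 2)) * ∑' n, t (n + m) := by
      rw [idempotentApprox, hT, ← hts.sum_add_tsum_nat_add m]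
      ring
    rw [this]
    refine (norm_mul_le _ _).trans (mul_le_mul_of_nonneg_left ?_ (norm_nonneg _))
    have hg := ((hasSum_geometric_of_lt_one (r := (1 / 4 : ℝ)) (by norm_num)
      (by norm_num)).mul_left (C * (1 / 4) ^ m))
    have hC : 0 ≤ C := by simpa using (norm_nonneg _).trans (hb 0)
    refine (tsum_of_norm_bounded hg fun n => ?_).trans ?_
    · refine (htn _).trans_eq ?_
      rw [pow_add]; ring
    · have : 0 ≤ C * (1 / 4) ^ m := by positivity
      have h4 : ((1 : ℝ) - 1 / 4)⁻¹ ≤ 2 := by norm_num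
      nlinarith
  · have hφe : φ (algebraMap ℂ A (1 / 2) + (b - algebraMap ℂ A (1 / 2)) * T) =
        1 / 2 + (φ b - 1 / 2) * φ T := by
      simp only [map_add, map_mul, map_sub, AlgHomClass.commutes, Algebra.algebraMap_self,
        RingHom.id_apply]
    have h01 := hidem.map φ
    rw [hφe] at h01 ⊢
    have hφs : φ s = 4 * (φ b ^ 2 - φ b) := by
      rw [hs, map_mul, map_sub, map_pow, map_ofNat]
    have hφT (h7 : ‖φ s‖ ≤ 1 / 7) : ‖φ T - 1‖ ≤ 1 / 6 := by
      have h1 : T = 1 + ∑' n, t (n + 1) := by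
        rw [hT, hts.tsum_eq_zero_add]; simp [ht]
      have h2 : φ (∑' n, t (n + 1)) = ∑' n, φ (t (n + 1)) :=
        (CharacterSpace.toCLM φ).map_tsum ((summable_nat_add_iff 1).2 hts)
      rw [h1, map_add, map_one, add_sub_cancel_left, h2]
      refine tsum_of_norm_bounded (g := fun n : ℕ => (1 / 7 : ℝ) * (1 / 7) ^ n) ?_ fun n => ?_
      · have h3 := (hasSum_geometric_of_lt_one (r := (1 / 7 : ℝ)) (by norm_num)
          (by norm_num)).mul_left (1 / 7)
        rwa [show (1 / 7 : ℝ) * (1 - 1 / 7)⁻¹ = 1 / 6 by norm_num] at h3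
      · rw [ht, map_smul, map_pow, norm_smul, norm_pow, ← pow_succ', ← one_mul ((1 / 7 : ℝ) ^ _)]
        gcongr
        exact norm_choose_neg_half_le_one _
    have hident : 1 / 2 + (φ b - 1 / 2) * φ T - φ b = (φ b - 1 / 2) * (φ T - 1) := by ring
    have key (h7 : ‖φ s‖ ≤ 1 / 7) (h2 : ‖φ b - 1 / 2‖ ≤ 1) :
        ‖1 / 2 + (φ b - 1 / 2) * φ T - φ b‖ ≤ 1 / 6 := by
      rw [hident, norm_mul]
      calc _ ≤ 1 * (1 / 6 : ℝ) := by gcongr; exact hφT h7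
        _ = _ := one_mul _
    have bound {x y : ℂ} (hx : ‖x‖ ≤ 1 / 32) (hy : ‖y‖ ≤ 33 / 32) (h : φ s = 4 * (x * y)) :
        ‖φ s‖ ≤ 1 / 7 := by
      rw [h, norm_mul, norm_mul]
      have : ‖x‖ * ‖y‖ ≤ 1 / 32 * (33 / 32) := by gcongr
      norm_num at this ⊢
      linarith
    set w := 1 / 2 + (φ b - 1 / 2) * φ T
    have h01' : w = 0 ∨ w = 1 := IsIdempotentElem.iff_eq_zero_or_one.mp h01
    constructor
    · intro h
      have hb1 : ‖φ b - 1‖ ≤ 33 / 32 := (norm_sub_le _ _).trans (by norm_num; linarith)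
      have hb2 : ‖φ b - 1 / 2‖ ≤ 1 := (norm_sub_le _ _).trans (by norm_num; linarith)
      have h3 := key (bound h hb1 (by rw [hφs]; ring)) hb2
      refine h01'.resolve_right fun hw => ?_
      rw [hw, norm_sub_rev] at h3
      have := norm_sub_norm_le (1 : ℂ) (1 - φ b)
      rw [norm_sub_rev] at h3
      rw [norm_one, sub_sub_cancel] at this
      linarith
    · intro h
      have hb1 : ‖φ b‖ ≤ 33 / 32 := by
        have := norm_add_le (φ b - 1) 1
        rw [sub_add_cancel, norm_one] at this
        linarith
      have hb2 : ‖φ b - 1 / 2‖ ≤ 1 := by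
        have := norm_add_le (φ b - 1) (1 / 2)
        rw [show φ b - 1 + 1 / 2 = φ b - 1 / 2 by ring] at this
        norm_num at this ⊢
        linarith
      have h3 := key (bound h hb1 (by rw [hφs]; ring)) hb2
      refine h01'.resolve_left fun hw => ?_
      rw [hw, zero_sub, norm_neg] at h3
      have := norm_add_le (1 - φ b) (φ b)
      rw [sub_add_cancel, norm_one, norm_sub_rev] at this
      linarith

theorem isUnit_of_forall_apply_ne_zero {x : A} (h : ∀ φ : characterSpace ℂ A, φ x ≠ 0) :
    IsUnit x := by
  by_contra hx
  obtain ⟨φ, hφ⟩ := CharacterSpace.exists_apply_eq_zero hx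
  exact h φ hφ

theorem IsIdempotentElem.eq_of_forall_apply_eq {e f : A} (he : IsIdempotentElem e)
    (hf : IsIdempotentElem f) (h : ∀ φ : characterSpace ℂ A, φ e = φ f) : e = f := by
  have hu : IsUnit (1 - (e - f) ^ 2) := isUnit_of_forall_apply_ne_zero fun φ => by
    simp [h φ]
  rw [IsIdempotentElem] at he hf
  have h0 : (1 - (e - f) ^ 2) * (e - f) = 0 := by
    linear_combination (-e - 1 + 3 * f) * he + (f + 1 - 3 * e) * hf
  exact sub_eq_zero.mp ((hu.mul_right_eq_zero).mp h0)

theorem exists_forall_norm_pow_le {s : A} {r : ℝ} (hr : 0 < r)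
    (hs : ∀ φ : characterSpace ℂ A, ‖φ s‖ < r) : ∃ C : ℝ, ∀ n, ‖s ^ n‖ ≤ C * r ^ n := by
  rcases subsingleton_or_nontrivial A with hA | hA
  · exact ⟨0, fun n => by simp [Subsingleton.elim (s ^ n) 0]⟩
  lift r to NNReal using hr.le
  have h1 : spectralRadius ℂ s < r := spectrum.spectralRadius_lt_of_forall_lt s fun z hz => by
    obtain ⟨φ, rfl⟩ := CharacterSpace.mem_spectrum_iff_exists.mp hz
    exact_mod_cast hs φ
  have h2 := (spectrum.pow_nnnorm_pow_one_div_tendsto_nhds_spectralRadius s).eventually_lt_const h1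
  obtain ⟨N, hN⟩ := (h2.and (eventually_gt_atTop 0)).exists_forall_of_atTop
  have h3 : ∀ n ≥ N, ‖s ^ n‖ ≤ (r : ℝ) ^ n := fun n hn => by
    obtain ⟨h4, h5⟩ := hN n hn
    have hn0 : (0 : ℝ) < n := by exact_mod_cast h5
    have h6 := ENNReal.rpow_le_rpow h4.le hn0.le
    rw [← ENNReal.rpow_mul, one_div_mul_cancel hn0.ne', ENNReal.rpow_one,
      ENNReal.rpow_natCast] at h6
    exact_mod_cast h6
  refine ⟨1 + ∑ n ∈ Finset.range N, ‖s ^ n‖ / (r : ℝ) ^ n, fun n => ?_⟩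
  have hS : ∀ i, 0 ≤ ‖s ^ i‖ / (r : ℝ) ^ i := fun i => by positivity
  have hrn : 0 < (r : ℝ) ^ n := by positivity
  rcases le_or_gt N n with h | h
  · refine (h3 n h).trans (le_mul_of_one_le_left hrn.le ?_)
    exact le_add_of_nonneg_right (Finset.sum_nonneg fun i _ => hS i)
  · rw [← div_le_iff₀ hrn]
    have := Finset.single_le_sum (fun i _ => hS i) (Finset.mem_range.mpr h)
    linarith

end Banach

section CauchyPompeiu

open MeasureTheory Complex Set

/-- Twice the Wirtinger derivative `∂χ/∂z̄`. -/
noncomputable def dbar (χ : ℂ → ℂ) (z : ℂ) : ℂ := fderiv ℝ χ z 1 + I * fderiv ℝ χ z I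

theorem dbar_mul_conj (χ : ℂ → ℂ) (z v : ℂ) :
    dbar χ z * (starRingEnd ℂ) v = fderiv ℝ χ z v + I * fderiv ℝ χ z (I * v) := by
  have h1 : v = v.re • (1 : ℂ) + v.im • I := by simp
  have h2 : I * v = v.re • I - v.im • (1 : ℂ) := by
    conv_lhs => rw [h1]
    simp only [real_smul, mul_one, mul_add]
    linear_combination (v.im : ℂ) * I_mul_I
  have h3 : (starRingEnd ℂ) v = v.re - v.im * I := Complex.ext (by simp) (by simp)
  have h4 : fderiv ℝ χ z v = v.re * fderiv ℝ χ z 1 + v.im * fderiv ℝ χ z I := by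
    conv_lhs => rw [h1, map_add, map_smul, map_smul, real_smul, real_smul]
  have h5 : fderiv ℝ χ z (I * v) = v.re * fderiv ℝ χ z I - v.im * fderiv ℝ χ z 1 := by
    rw [h2, map_sub, map_smul, map_smul, real_smul, real_smul]
  rw [dbar, h3, h4, h5]
  linear_combination (-(v.im : ℂ) * fderiv ℝ χ z I) * I_mul_I

theorem continuous_dbar {χ : ℂ → ℂ} (hχ : ContDiff ℝ 1 χ) : Continuous (dbar χ) := by
  have := hχ.continuous_fderiv (by norm_num)
  unfold dbar
  fun_prop

theorem support_dbar_subset (χ : ℂ → ℂ) : Function.support (dbar χ) ⊆ tsupport χ := by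
  intro z hz
  by_contra h
  refine hz ?_
  have : fderiv ℝ χ z = 0 := by
    by_contra h'
    exact h (support_fderiv_subset ℝ h')
  simp [dbar, this]

theorem integrableOn_polar_of_compactSupport {g : ℂ → ℝ → ℂ}
    (hg : Continuous fun p : ℂ × ℝ => g p.1 p.2) {K : Set ℂ} (hK : IsCompact K)
    (hgK : ∀ z ∉ K, ∀ θ, g z θ = 0) (w : ℂ) :
    Integrable (fun p : ℝ × ℝ => g (p.1 * exp (p.2 * I) + w) p.2)
      ((volume.restrict (Ioi (0 : ℝ))).prod (volume.restrict (Ioo (-Real.pi) Real.pi))) := by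
  obtain ⟨R, hR⟩ := hK.isBounded.subset_closedBall w
  rw [Measure.prod_restrict, ← Measure.volume_eq_prod]
  have hcont : Continuous fun p : ℝ × ℝ => g (p.1 * exp (p.2 * I) + w) p.2 :=
    hg.comp (f := fun p : ℝ × ℝ => ((p.1 * exp (p.2 * I) + w : ℂ), p.2)) (by fun_prop)
  have hcomp : IsCompact (Icc (0 : ℝ) R ×ˢ Icc (-Real.pi) Real.pi) :=
    isCompact_Icc.prod isCompact_Icc
  refine (hcont.continuousOn.integrableOn_compact hcomp).of_forall_sdiff_eq_zero
    (measurableSet_Ioi.prod measurableSet_Ioo) ?_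
  rintro ⟨r, θ⟩ ⟨⟨hr, hθ⟩, hn⟩
  refine hgK _ (fun hmem => hn ⟨⟨(le_of_lt hr), ?_⟩, ⟨hθ.1.le, hθ.2.le⟩⟩) _
  have h1 := hR hmem
  rw [Metric.mem_closedBall, dist_eq_norm, add_sub_cancel_right, norm_mul,
    norm_exp_ofReal_mul_I, mul_one, norm_real, Real.norm_eq_abs] at h1
  exact (le_abs_self r).trans h1

/-- The **Cauchy–Pompeiu formula** for compactly supported functions. -/
theorem integral_dbar_div_sub {χ : ℂ → ℂ} (hχ : ContDiff ℝ 1 χ) (hc : HasCompactSupport χ)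
    (w : ℂ) : ∫ z, dbar χ z / (z - w) = -(2 * Real.pi) * χ w := by
  have hdχ : Differentiable ℝ χ := hχ.differentiable (by norm_num)
  have hfc : Continuous (fderiv ℝ χ) := hχ.continuous_fderiv (by norm_num)
  have hf0 : ∀ z ∉ tsupport χ, fderiv ℝ χ z = 0 := fun z hz => by
    by_contra h'
    exact hz (support_fderiv_subset ℝ h')
  rw [← integral_add_right_eq_self _ w]
  simp only [add_sub_cancel_right]
  rw [← Complex.integral_comp_polarCoord_symm]
  have hpol : ∀ p ∈ polarCoord.target,
      p.1 • (dbar χ (Complex.polarCoord.symm p + w) / Complex.polarCoord.symm p) =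
      fderiv ℝ χ (p.1 * exp (p.2 * I) + w) (exp (p.2 * I)) +
        I * fderiv ℝ χ (p.1 * exp (p.2 * I) + w) (I * exp (p.2 * I)) := by
    rintro ⟨r, θ⟩ ⟨hr, hθ⟩
    have hr0 : (r : ℂ) ≠ 0 := by exact_mod_cast (ne_of_gt hr)
    have he : Complex.polarCoord.symm (r, θ) = r * exp (θ * I) := by
      rw [Complex.polarCoord_symm_apply, exp_mul_I, ofReal_cos, ofReal_sin]
    rw [he, ← dbar_mul_conj, ← exp_conj, map_mul, conj_I, conj_ofReal, mul_neg, exp_neg, real_smul]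
    have := exp_ne_zero (θ * I)
    field_simp
  rw [setIntegral_congr_fun (by exact measurableSet_Ioi.prod measurableSet_Ioo) hpol]
  have ha := integrableOn_polar_of_compactSupport
    (g := fun z θ => fderiv ℝ χ z (exp (θ * I))) (by fun_prop) hc
    (fun z hz θ => by simp [hf0 z hz]) w
  have hb := integrableOn_polar_of_compactSupport
    (g := fun z θ => I * fderiv ℝ χ z (I * exp (θ * I))) (by fun_prop) hc
    (fun z hz θ => by simp [hf0 z hz]) w
  rw [polarCoord_target, Measure.volume_eq_prod, ← Measure.prod_restrict, integral_add ha hb,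
    integral_prod_symm _ ha, integral_prod _ hb]
  have hrad : ∀ θ : ℝ, ∫ r in Ioi (0 : ℝ),
      fderiv ℝ χ (r * exp (θ * I) + w) (exp (θ * I)) = -χ w := fun θ => by
    have hder : ∀ r : ℝ, HasDerivAt (fun r : ℝ => χ (r * exp (θ * I) + w))
        (fderiv ℝ χ (r * exp (θ * I) + w) (exp (θ * I))) r := fun r => by
      have h1 : HasDerivAt (fun r : ℝ => (r : ℂ) * exp (θ * I) + w) (exp (θ * I)) r := by
        simpa using ((ofRealCLM.hasDerivAt (x := r)).mul_const (exp (θ * I))).add_const w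
      exact (hdχ _).hasFDerivAt.comp_hasDerivAt r h1
    have hiso : Isometry fun r : ℝ => (r : ℂ) * exp (θ * I) + w := by
      refine Isometry.of_dist_eq fun x y => ?_
      rw [dist_add_right, dist_eq_norm, ← sub_mul, norm_mul, norm_exp_ofReal_mul_I, mul_one,
        ← ofReal_sub, norm_real, dist_eq_norm]
    have := HasCompactSupport.integral_Ioi_deriv_eq (f := fun r : ℝ => χ (r * exp (θ * I) + w))
      (hχ.comp ((ofRealCLM.contDiff.mul contDiff_const).add contDiff_const))
      (hc.comp_isClosedEmbedding hiso.isClosedEmbedding) 0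
    simpa [(hder _).deriv] using this
  have hang : ∀ r ∈ Ioi (0 : ℝ), ∫ θ in Ioo (-Real.pi) Real.pi,
      I * fderiv ℝ χ (r * exp (θ * I) + w) (I * exp (θ * I)) = 0 := fun r hr => by
    have hder : ∀ θ : ℝ, HasDerivAt (fun θ : ℝ => χ (r * exp (θ * I) + w))
        (r * fderiv ℝ χ (r * exp (θ * I) + w) (I * exp (θ * I))) θ := fun θ => by
      have h1 : HasDerivAt (fun θ : ℝ => (r : ℂ) * exp (θ * I) + w)
          (r • (I * exp (θ * I))) θ := by
        have h2 := ((ofRealCLM.hasDerivAt (x := θ)).mul_const I).cexp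
        simpa [mul_comm] using (h2.const_mul (r : ℂ)).add_const w
      have h3 := (hdχ _).hasFDerivAt.comp_hasDerivAt θ h1
      rwa [map_smul, real_smul] at h3
    have hr0 : (r : ℂ) ≠ 0 := by exact_mod_cast (ne_of_gt hr)
    have h4 := intervalIntegral.integral_eq_sub_of_hasDerivAt (a := -Real.pi) (b := Real.pi)
      (fun θ _ => hder θ) (by
        apply Continuous.intervalIntegrable
        fun_prop)
    have h5 : exp (((-Real.pi : ℝ) : ℂ) * I) = exp ((Real.pi : ℂ) * I) := by
      rw [ofReal_neg, neg_mul, exp_neg, exp_pi_mul_I]; norm_num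
    rw [h5, sub_self, intervalIntegral.integral_const_mul, mul_eq_zero, or_iff_right hr0,
      intervalIntegral.integral_of_le (by linarith [Real.pi_pos]),
      integral_Ioc_eq_integral_Ioo] at h4
    rw [integral_const_mul, h4, mul_zero]
  rw [setIntegral_congr_fun measurableSet_Ioi hang]
  simp only [hrad]
  rw [setIntegral_const]
  simp [Measure.real, Real.pi_pos.le, two_mul]
  ring

theorem exists_bound_integral_inv_norm_sub (R : ℝ) : ∃ C : ℝ, ∀ w : ℂ,
    IntegrableOn (fun z => ‖z - w‖⁻¹) (Metric.closedBall 0 R) ∧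
      ∫ z in Metric.closedBall 0 R, ‖z - w‖⁻¹ ≤ C := by
  set f : ℝ → ℝ := (Iio 1).indicator fun y => y⁻¹
  have hf : Integrable (fun z : ℂ => f ‖z‖) := by
    rw [integrable_fun_norm_addHaar, finrank_real_complex]
    have h1 : IntegrableOn (fun _ : ℝ => (1 : ℝ)) (Ioo 0 1) := by simp
    have h2 : IntegrableOn (fun y : ℝ => y ^ (2 - 1) • f y) (Ioo 0 1) := by
      refine h1.congr_fun (fun y hy => ?_) measurableSet_Ioo
      have : f y = y⁻¹ := indicator_of_mem (show y ∈ Iio 1 from hy.2) _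
      simp [this, hy.1.ne']
    refine h2.of_forall_sdiff_eq_zero measurableSet_Ioi fun y hy => ?_
    have : f y = 0 := indicator_of_notMem (s := Iio (1 : ℝ)) (fun h => hy.2 ⟨hy.1, h⟩) _
    simp [this]
  have hf0 : ∀ y, 0 ≤ y → 0 ≤ f y := fun y hy => by
    simp only [f, indicator_apply]
    split_ifs
    exacts [inv_nonneg.mpr hy, le_rfl]
  have hle : ∀ z : ℂ, ‖z‖⁻¹ ≤ 1 + f ‖z‖ := fun z => by
    rcases lt_or_ge ‖z‖ 1 with h | h
    · have : f ‖z‖ = ‖z‖⁻¹ := indicator_of_mem (show ‖z‖ ∈ Iio 1 from h) _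
      rw [this]; linarith
    · exact (inv_le_one_of_one_le₀ h).trans (le_add_of_nonneg_right (hf0 _ (norm_nonneg _)))
  refine ⟨volume.real (Metric.closedBall (0 : ℂ) R) + ∫ z : ℂ, f ‖z‖, fun w => ?_⟩
  have h1 : IntegrableOn (fun _ : ℂ => (1 : ℝ)) (Metric.closedBall 0 R) :=
    integrableOn_const measure_closedBall_lt_top.ne
  have h2 : Integrable fun z : ℂ => f ‖z - w‖ := hf.comp_sub_right w
  have h3 := h1.add h2.integrableOn
  have h4 : IntegrableOn (fun z => ‖z - w‖⁻¹) (Metric.closedBall 0 R) := by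
    refine h3.mono' (by fun_prop) (ae_of_all _ fun z => ?_)
    rw [norm_inv, norm_norm]
    exact hle _
  refine ⟨h4, ?_⟩
  calc ∫ z in Metric.closedBall 0 R, ‖z - w‖⁻¹
      ≤ ∫ z in Metric.closedBall 0 R, (1 + f ‖z - w‖) :=
        setIntegral_mono h4 h3 fun z => hle _
    _ = volume.real (Metric.closedBall (0 : ℂ) R) +
        ∫ z in Metric.closedBall 0 R, f ‖z - w‖ := by
        rw [integral_add h1 h2.integrableOn]; simp
    _ ≤ _ := by
        gcongr
        rw [← integral_sub_right_eq_self (fun z : ℂ => f ‖z‖) w]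
        exact setIntegral_le_integral h2 (ae_of_all _ fun z => hf0 _ (norm_nonneg _))

end CauchyPompeiu

section CauchyTransform

open MeasureTheory Set

theorem exists_norm_sub_integral_le (R : ℝ) : ∃ C : ℝ, 0 ≤ C ∧ ∀ {F g : ℂ → ℂ} {w : ℂ} {δ : ℝ},
    ContDiff ℝ 1 F → tsupport F ⊆ Metric.closedBall 0 R → Continuous g →
    (∀ z, ‖dbar F z - (w - z) * g z‖ ≤ δ) →
    ‖F w - (1 / (2 * Real.pi) : ℂ) * ∫ z in Metric.closedBall 0 R, g z‖ ≤ C * δ := by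
  obtain ⟨C, hC⟩ := exists_bound_integral_inv_norm_sub R
  have hC0 : 0 ≤ C := (integral_nonneg fun z => by positivity).trans (hC 0).2
  refine ⟨C, hC0, fun {F g w δ} hF hs hg hδ => ?_⟩
  have hδ0 : 0 ≤ δ := (norm_nonneg _).trans (hδ 0)
  have hcs : HasCompactSupport F :=
    (isCompact_closedBall (0 : ℂ) R).of_isClosed_subset (isClosed_tsupport F) hs
  have hgi : IntegrableOn g (Metric.closedBall 0 R) :=
    hg.continuousOn.integrableOn_compact (isCompact_closedBall _ _)
  have hri : IntegrableOn (fun z => (dbar F z - (w - z) * g z) / (z - w))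
      (Metric.closedBall 0 R) := by
    refine ((hC w).1.const_mul δ).mono' ?_ (ae_of_all _ fun z => ?_)
    · have := continuous_dbar hF
      exact (Measurable.div (by fun_prop) (by fun_prop)).aestronglyMeasurable
    · rw [norm_div, div_eq_mul_inv]
      gcongr
      exact hδ z
  have hae : ∀ᵐ z ∂volume.restrict (Metric.closedBall (0 : ℂ) R),
      dbar F z / (z - w) = (dbar F z - (w - z) * g z) / (z - w) - g z := by
    filter_upwards [ae_restrict_of_ae (compl_mem_ae_iff.mpr (measure_singleton w))] with z hz
    have : z - w ≠ 0 := sub_ne_zero.mpr hz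
    field_simp
    ring
  have hint : ∫ z in Metric.closedBall 0 R, dbar F z / (z - w) = -(2 * Real.pi) * F w := by
    rw [← integral_dbar_div_sub hF hcs w]
    refine setIntegral_eq_integral_of_forall_compl_eq_zero fun z hz => ?_
    have : dbar F z = 0 := by
      by_contra h
      exact hz (hs (support_dbar_subset F h))
    rw [this, zero_div]
  rw [integral_congr_ae hae, integral_sub hri hgi] at hint
  have hpi : (Real.pi : ℂ) ≠ 0 := by exact_mod_cast Real.pi_ne_zero
  have heq : F w - (1 / (2 * Real.pi) : ℂ) * ∫ z in Metric.closedBall 0 R, g z =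
      -(1 / (2 * Real.pi) : ℂ) *
        ∫ z in Metric.closedBall 0 R, (dbar F z - (w - z) * g z) / (z - w) := by
    field_simp
    linear_combination hint
  have hle : ‖∫ z in Metric.closedBall 0 R, (dbar F z - (w - z) * g z) / (z - w)‖ ≤ C * δ := by
    refine (norm_integral_le_of_norm_le ((hC w).1.const_mul δ) (ae_of_all _ fun z => ?_)).trans ?_
    · rw [norm_div, div_eq_mul_inv]
      gcongr
      exact hδ z
    · rw [integral_const_mul, mul_comm]
      gcongr
      exact (hC w).2
  rw [heq, norm_mul]
  have h1 : ‖-(1 / (2 * Real.pi) : ℂ)‖ ≤ 1 := by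
    rw [norm_neg, norm_div, norm_one, norm_mul, Complex.norm_real, Real.norm_eq_abs,
      abs_of_pos Real.pi_pos, Complex.norm_two]
    rw [div_le_one (by positivity)]
    linarith [Real.pi_gt_three]
  calc _ ≤ 1 * (C * δ) := by gcongr
    _ = _ := one_mul _

theorem exists_smooth_partition {K : Set ℂ} (hK : IsCompact K) {D : ℂ → Set ℂ}
    (hD : ∀ z, D z ∈ 𝓝 z) : ∃ (t : Finset ℂ) (χ : t → ℂ → ℂ),
      (∀ i, ContDiff ℝ 1 (χ i) ∧ HasCompactSupport (χ i) ∧ tsupport (χ i) ⊆ D i) ∧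
      (∀ z ∈ K, ∑ i, χ i z = 1) ∧ ∀ z, ∑ i, ‖χ i z‖ ≤ 1 := by
  obtain ⟨t, -, ht⟩ := hK.elim_nhds_subcover (fun z => interior (D z) ∩ Metric.ball z 1)
    fun z _ => inter_mem (interior_mem_nhds.mpr (hD z)) (Metric.ball_mem_nhds z one_pos)
  obtain ⟨f, hf⟩ := SmoothPartitionOfUnity.exists_isSubordinate (modelWithCornersSelf ℝ ℂ)
    hK.isClosed (fun i : t => interior (D i) ∩ Metric.ball (i : ℂ) 1)
    (fun i => isOpen_interior.inter Metric.isOpen_ball) (ht.trans (by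
      intro z hz
      simpa using hz))
  have hts : ∀ i, tsupport (fun z => (f i z : ℂ)) ⊆ tsupport (f i) := fun i =>
    closure_mono fun z hz h => hz (by simpa using h)
  refine ⟨t, fun i z => f i z, fun i => ⟨?_, ?_, ?_⟩, fun z hz => ?_, fun z => ?_⟩
  · exact Complex.ofRealCLM.contDiff.comp
      ((f i).contMDiff.contDiff.of_le (by exact_mod_cast le_top))
  · exact (isCompact_closedBall (i : ℂ) 1).of_isClosed_subset (isClosed_tsupport _)
      ((hts i).trans ((hf i).trans (inter_subset_right.trans Metric.ball_subset_closedBall)))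
  · exact (hts i).trans ((hf i).trans (inter_subset_left.trans interior_subset))
  · have := f.sum_eq_one hz
    rw [finsum_eq_sum_of_fintype] at this
    simpa using congrArg Complex.ofReal this
  · have := f.sum_le_one z
    rw [finsum_eq_sum_of_fintype] at this
    simpa [abs_of_nonneg (f.nonneg _ z)] using this

end CauchyTransform

section Fiber

variable {A : Type*} [NormedCommRing A] [NormedAlgebra ℂ A]

/-- The closed ideal generated by `a - z`. -/
def fiberIdeal (a : A) (z : ℂ) : Ideal A := (Ideal.span {a - algebraMap ℂ A z}).closure

instance isClosed_fiberIdeal (a : A) (z : ℂ) : IsClosed (fiberIdeal a z : Set A) :=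
  isClosed_closure

theorem sub_mul_mem_fiberIdeal (a : A) (z : ℂ) (g : A) :
    (a - algebraMap ℂ A z) * g ∈ fiberIdeal a z :=
  subset_closure (Ideal.mul_mem_right _ _ (Ideal.mem_span_singleton_self _))

theorem norm_mk_fiberIdeal_le (a : A) (z : ℂ) (x g : A) :
    ‖Ideal.Quotient.mk (fiberIdeal a z) x‖ ≤ ‖x - (a - algebraMap ℂ A z) * g‖ := by
  have : Ideal.Quotient.mk (fiberIdeal a z) x =
      Ideal.Quotient.mk (fiberIdeal a z) (x - (a - algebraMap ℂ A z) * g) :=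
    Ideal.Quotient.eq.mpr (by simpa using sub_mul_mem_fiberIdeal a z g)
  rw [this]
  exact Ideal.Quotient.norm_mk_le _ _

theorem exists_norm_sub_mul_lt {a : A} {z : ℂ} {x : A} {ε : ℝ}
    (h : ‖Ideal.Quotient.mk (fiberIdeal a z) x‖ < ε) :
    ∃ g, ‖x - (a - algebraMap ℂ A z) * g‖ < ε := by
  obtain ⟨δ, hδ, hδε⟩ := exists_between h
  obtain ⟨m, hm, hmn⟩ := Ideal.Quotient.norm_mk_lt
    (Ideal.Quotient.mk (fiberIdeal a z) x) (sub_pos.mpr hδ)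
  rw [add_sub_cancel] at hmn
  have hmem : x - m ∈ closure (Ideal.span {a - algebraMap ℂ A z} : Set A) :=
    Ideal.Quotient.eq.mp hm.symm
  obtain ⟨y, hy, hyd⟩ := Metric.mem_closure_iff.mp hmem (ε - δ) (sub_pos.mpr hδε)
  obtain ⟨g, rfl⟩ := Ideal.mem_span_singleton'.mp hy
  refine ⟨g, ?_⟩
  rw [dist_eq_norm] at hyd
  calc ‖x - (a - algebraMap ℂ A z) * g‖ = ‖m + (x - m - g * (a - algebraMap ℂ A z))‖ := by
        congr 1; ring
    _ ≤ ‖m‖ + ‖x - m - g * (a - algebraMap ℂ A z)‖ := norm_add_le _ _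
    _ < ε := by linarith

variable [CompleteSpace A]

theorem norm_apply_le_norm_one_mul (φ : characterSpace ℂ A) (x : A) : ‖φ x‖ ≤ ‖(1 : A)‖ * ‖x‖ := by
  rw [mul_comm]
  exact AlgHom.norm_apply_le_self_mul_norm_one (CharacterSpace.toAlgHom φ) x

theorem norm_apply_fiberIdeal_le {a : A} {z : ℂ} (ψ : characterSpace ℂ (A ⧸ fiberIdeal a z))
    (x : A ⧸ fiberIdeal a z) : ‖ψ x‖ ≤ ‖(1 : A)‖ * ‖x‖ := by
  refine (norm_apply_le_norm_one_mul ψ x).trans ?_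
  gcongr
  exact Ideal.Quotient.norm_mk_le (fiberIdeal a z) (1 : A)

/-- The character of `A` induced by a character of `A ⧸ fiberIdeal a z`. -/
noncomputable def fiberPullback {a : A} {z : ℂ} (ψ : characterSpace ℂ (A ⧸ fiberIdeal a z)) :
    characterSpace ℂ A :=
  CharacterSpace.equivAlgHom.symm
    ((CharacterSpace.toAlgHom ψ).comp (Ideal.Quotient.mkₐ ℂ (fiberIdeal a z)))

theorem fiberPullback_apply {a : A} {z : ℂ} (ψ : characterSpace ℂ (A ⧸ fiberIdeal a z)) (x : A) :
    fiberPullback ψ x = ψ (Ideal.Quotient.mk (fiberIdeal a z) x) := rfl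

theorem continuous_fiberPullback {a : A} {z : ℂ} :
    Continuous (fiberPullback : characterSpace ℂ (A ⧸ fiberIdeal a z) → characterSpace ℂ A) :=
  Continuous.subtype_mk (WeakDual.continuous_of_continuous_eval fun x =>
    (WeakDual.eval_continuous (Ideal.Quotient.mk (fiberIdeal a z) x)).comp
      continuous_subtype_val) _

theorem fiberPullback_apply_self {a : A} {z : ℂ} (ψ : characterSpace ℂ (A ⧸ fiberIdeal a z)) :
    fiberPullback ψ a = z := by
  have h : Ideal.Quotient.mk (fiberIdeal a z) a = algebraMap ℂ _ z :=
    Ideal.Quotient.eq.mpr (by simpa using sub_mul_mem_fiberIdeal a z 1)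
  rw [fiberPullback_apply, h]
  exact AlgHom.commutes (CharacterSpace.toAlgHom ψ) z

theorem exists_fiberPullback_eq {a : A} {z : ℂ} {φ : characterSpace ℂ A} (h : φ a = z) :
    ∃ ψ : characterSpace ℂ (A ⧸ fiberIdeal a z), fiberPullback ψ = φ := by
  have hle : fiberIdeal a z ≤ RingHom.ker (CharacterSpace.toAlgHom φ) := by
    have hc : IsClosed (RingHom.ker (CharacterSpace.toAlgHom φ) : Set A) :=
      isClosed_singleton.preimage (map_continuous φ)
    refine closure_minimal (fun x hx => ?_) hc
    have := (Ideal.span_singleton_le_iff_mem (x := a - algebraMap ℂ A z)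
      (RingHom.ker (CharacterSpace.toAlgHom φ))).mpr ?_
    · exact this hx
    · rw [RingHom.mem_ker, map_sub, AlgHom.commutes, sub_eq_zero]
      exact h
  refine ⟨CharacterSpace.equivAlgHom.symm (Ideal.Quotient.liftₐ (fiberIdeal a z)
    (CharacterSpace.toAlgHom φ) fun x hx => hle hx), ?_⟩
  ext x
  rfl

theorem dbar_sum_mul {ι : Type*} [Fintype ι] {χ : ι → ℂ → ℂ} {z : ℂ}
    (hχ : ∀ i, DifferentiableAt ℝ (χ i) z) (c : ι → ℂ) :
    dbar (fun z => ∑ i, χ i z * c i) z = ∑ i, dbar (χ i) z * c i := by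
  have h : HasFDerivAt (fun z => ∑ i, χ i z * c i) (∑ i, (c i • fderiv ℝ (χ i) z)) z :=
    HasFDerivAt.fun_sum fun i _ => (hχ i).hasFDerivAt.mul_const (c i)
  rw [dbar, h.fderiv]
  simp only [sum_apply, smul_apply, Finset.mul_sum,
    ← Finset.sum_add_distrib, dbar, smul_eq_mul]
  exact Finset.sum_congr rfl fun i _ => by ring

theorem norm_mk_fiberIdeal_eq_zero {a : A} {z : ℂ} (hz : ‖a‖ * ‖(1 : A)‖ < ‖z‖) (x : A) :
    ‖Ideal.Quotient.mk (fiberIdeal a z) x‖ = 0 := by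
  have hu : z ∉ spectrum ℂ a := fun h => not_lt.mpr (spectrum.norm_le_norm_mul_of_mem h) hz
  rw [spectrum.notMem_iff] at hu
  obtain ⟨u, hu⟩ := hu.neg
  refine le_antisymm ((norm_mk_fiberIdeal_le a z x (u⁻¹ * x : A)).trans_eq ?_) (norm_nonneg _)
  rw [← neg_sub (algebraMap ℂ A z) a, ← hu, Units.mul_inv_cancel_left, sub_self, norm_zero]

/-- A function on the character space which is fibrewise given by elements of the quotients
`A ⧸ fiberIdeal a z` that are locally uniformly approximable by elements of `A` is a uniform limit
of Gelfand transforms. -/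
theorem exists_norm_apply_sub_lt {a : A} {e : ∀ z, A ⧸ fiberIdeal a z}
    {f : characterSpace ℂ A → ℂ}
    (hf : ∀ z (ψ : characterSpace ℂ (A ⧸ fiberIdeal a z)), ψ (e z) = f (fiberPullback ψ))
    (he : ∀ z₀ : ℂ, ∃ D ∈ 𝓝 z₀, ∀ ε > 0, ∃ b : A, ∀ z ∈ D,
      ‖Ideal.Quotient.mk (fiberIdeal a z) b - e z‖ < ε) {ε : ℝ} (hε : 0 < ε) :
    ∃ b : A, ∀ φ : characterSpace ℂ A, ‖φ b - f φ‖ < ε := by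
  choose D hD hb using he
  set R := ‖a‖ * ‖(1 : A)‖ + 1 with hR
  obtain ⟨t, χ, hχ, hχ1, hχle⟩ := exists_smooth_partition (isCompact_closedBall (0 : ℂ) R) hD
  have hχd : ∀ i z, DifferentiableAt ℝ (χ i) z := fun i =>
    (hχ i).1.differentiable (by norm_num)
  obtain ⟨R', hR'⟩ := (isCompact_iUnion fun i => (hχ i).2.1).isBounded.subset_closedBall (0 : ℂ)
  obtain ⟨C, hC0, hC⟩ := exists_norm_sub_integral_le R'
  have hdc : ∀ i, Continuous (dbar (χ i)) := fun i => continuous_dbar (hχ i).1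
  have hdb : ∀ i, ∃ M, ∀ z, ‖dbar (χ i) z‖ ≤ M := fun i =>
    (hdc i).bounded_above_of_compact_support ((hχ i).2.1.mono' (support_dbar_subset _))
  choose M' hM' using hdb
  set M := ∑ i, M' i
  have hM : ∀ z, ∑ i, ‖dbar (χ i) z‖ ≤ M := fun z => Finset.sum_le_sum fun i _ => hM' i z
  have hM0 : 0 ≤ M := (Finset.sum_nonneg fun i _ => norm_nonneg _).trans (hM 0)
  set L := ‖(1 : A)‖ + C * (‖(1 : A)‖ * (M + 1)) with hL
  have hL0 : 0 ≤ L := by positivity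
  set η := ε / (L + 1) with hη
  have hη0 : 0 < η := by positivity
  have hLη : L * η < ε := by
    rw [hη, mul_div_assoc', div_lt_iff₀ (by positivity)]
    nlinarith
  choose b hb' using fun i : t => hb i η hη0
  set H : ℂ → A := fun z => ∑ i, dbar (χ i) z • b i with hH
  have hHc : Continuous H := by fun_prop
  have hHn : ∀ z, ‖Ideal.Quotient.mk (fiberIdeal a z) (H z)‖ < (M + 1) * η := fun z => by
    by_cases hz : z ∈ Metric.ball (0 : ℂ) R
    · have h0 : ∑ i, dbar (χ i) z = 0 := by
        have h1 : (fun z => ∑ i, χ i z * 1) =ᶠ[𝓝 z] fun _ => 1 := by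
          filter_upwards [Metric.isOpen_ball.mem_nhds hz] with y hy
          simpa using hχ1 y (Metric.ball_subset_closedBall hy)
        have h2 := dbar_sum_mul (fun i => hχd i z) fun _ => 1
        rw [dbar, h1.fderiv_eq] at h2
        simpa using h2.symm
      have h1 : Ideal.Quotient.mk (fiberIdeal a z) (H z) =
          ∑ i, dbar (χ i) z • (Ideal.Quotient.mk (fiberIdeal a z) (b i) - e z) := by
        simp only [smul_sub, Finset.sum_sub_distrib, ← Finset.sum_smul, h0, zero_smul, sub_zero,
          hH, map_sum]
        rfl
      rw [h1]
      calc ‖∑ i, dbar (χ i) z • (Ideal.Quotient.mk (fiberIdeal a z) (b i) - e z)‖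
          ≤ ∑ i, ‖dbar (χ i) z‖ * η := by
            refine norm_sum_le_of_le _ fun i _ => ?_
            rw [norm_smul]
            by_cases h : dbar (χ i) z = 0
            · simp [h]
            · gcongr
              exact (hb' i z ((hχ i).2.2 (support_dbar_subset _ h))).le
        _ = (∑ i, ‖dbar (χ i) z‖) * η := by rw [Finset.sum_mul]
        _ ≤ M * η := by gcongr; exact hM z
        _ < _ := by gcongr; linarith
    · rw [norm_mk_fiberIdeal_eq_zero]
      · positivity
      · rw [mem_ball_zero_iff, not_lt] at hz
        linarith
  obtain ⟨G, hG⟩ := exists_continuous_forall_mem_convex_of_local_const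
    (t := fun z : ℂ => {g : A | ‖H z - (a - algebraMap ℂ A z) * g‖ < (M + 1) * η})
    (fun z g₁ h₁ g₂ h₂ s r hs hr hsr => by
      have h3 : H z - (a - algebraMap ℂ A z) * (s • g₁ + r • g₂) =
          s • (H z - (a - algebraMap ℂ A z) * g₁) + r • (H z - (a - algebraMap ℂ A z) * g₂) := by
        have : H z = s • H z + r • H z := by rw [← add_smul, hsr, one_smul]
        conv_lhs => rw [this]
        simp only [mul_add, mul_smul_comm, smul_sub]
        abel
      have hball := convex_ball (0 : A) ((M + 1) * η) (mem_ball_zero_iff.mpr h₁)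
        (mem_ball_zero_iff.mpr h₂) hs hr hsr
      rw [← h3] at hball
      exact mem_ball_zero_iff.mp hball)
    (fun z => by
      obtain ⟨g, hg⟩ := exists_norm_sub_mul_lt (hHn z)
      refine ⟨g, Tendsto.eventually_lt_const hg ?_⟩
      have := (algebraMapCLM ℂ A).continuous
      have h2 : Continuous fun z => ‖H z - (a - algebraMapCLM ℂ A z) * g‖ := by fun_prop
      exact h2.tendsto z)
  refine ⟨(1 / (2 * Real.pi) : ℂ) • ∫ z in Metric.closedBall 0 R', G z, fun φ => ?_⟩
  have hφb : φ ((1 / (2 * Real.pi) : ℂ) • ∫ z in Metric.closedBall 0 R', G z) =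
      (1 / (2 * Real.pi) : ℂ) * ∫ z in Metric.closedBall 0 R', φ (G z) := by
    rw [map_smul, smul_eq_mul]
    congr 1
    exact (ContinuousLinearMap.integral_comp_comm (CharacterSpace.toCLM φ)
      (G.continuous.continuousOn.integrableOn_compact (ProperSpace.isCompact_closedBall _ _))).symm
  set F : ℂ → ℂ := fun z => ∑ i, χ i z * φ (b i) with hF
  have h1 : ‖F (φ a) - φ ((1 / (2 * Real.pi) : ℂ) • ∫ z in Metric.closedBall 0 R', G z)‖ ≤
      C * (‖(1 : A)‖ * ((M + 1) * η)) := by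
    rw [hφb]
    refine hC (ContDiff.sum fun i _ => (hχ i).1.mul contDiff_const) ?_
      ((map_continuous φ).comp G.continuous) fun z => ?_
    · refine closure_minimal (fun z hz => ?_) Metric.isClosed_closedBall
      obtain ⟨i, -, hi⟩ := Finset.exists_ne_zero_of_sum_ne_zero hz
      exact hR' (Set.mem_iUnion.mpr ⟨i, subset_closure (left_ne_zero_of_mul hi)⟩)
    · have h2 : dbar F z - (φ a - z) * φ (G z) = φ (H z - (a - algebraMap ℂ A z) * G z) := by
        have h3 : φ (algebraMap ℂ A z) = z := AlgHom.commutes (CharacterSpace.toAlgHom φ) z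
        rw [hF, dbar_sum_mul fun i => hχd i z]
        simp [hH, h3]
      rw [h2]
      refine (norm_apply_le_norm_one_mul φ _).trans ?_
      gcongr
      exact (hG z).le
  have h2 : ‖F (φ a) - f φ‖ ≤ ‖(1 : A)‖ * η := by
    have hs : ∑ i, χ i (φ a) = 1 := by
      refine hχ1 _ (mem_closedBall_zero_iff.mpr ?_)
      have := norm_apply_le_norm_one_mul φ a
      rw [mul_comm] at this
      linarith
    have h3 : F (φ a) - f φ = ∑ i, χ i (φ a) * (φ (b i) - f φ) := by
      simp only [hF, mul_sub, Finset.sum_sub_distrib, ← Finset.sum_mul, hs, one_mul]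
    rw [h3]
    obtain ⟨ψ, hψ⟩ := exists_fiberPullback_eq (rfl : φ a = φ a)
    calc ‖∑ i, χ i (φ a) * (φ (b i) - f φ)‖ ≤ ∑ i, ‖χ i (φ a)‖ * (‖(1 : A)‖ * η) := by
          refine norm_sum_le_of_le _ fun i _ => ?_
          rw [norm_mul]
          by_cases h : χ i (φ a) = 0
          · simp [h]
          · have h4 : φ (b i) - f φ =
                ψ (Ideal.Quotient.mk (fiberIdeal a (φ a)) (b i) - e (φ a)) := by
              rw [map_sub, hf, ← fiberPullback_apply, hψ]
            rw [h4]
            gcongr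
            refine (norm_apply_fiberIdeal_le ψ _).trans ?_
            gcongr
            exact (hb' i _ ((hχ i).2.2 (subset_closure h))).le
      _ = (∑ i, ‖χ i (φ a)‖) * (‖(1 : A)‖ * η) := by rw [Finset.sum_mul]
      _ ≤ 1 * (‖(1 : A)‖ * η) := by gcongr; exact hχle _
      _ = _ := one_mul _
  calc _ = ‖(F (φ a) - f φ) -
        (F (φ a) - φ ((1 / (2 * Real.pi) : ℂ) • ∫ z in Metric.closedBall 0 R', G z))‖ := by
        congr 1; ring
    _ ≤ ‖(1 : A)‖ * η + C * (‖(1 : A)‖ * ((M + 1) * η)) := (norm_sub_le _ _).trans (by gcongr)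
    _ = L * η := by rw [hL]; ring
    _ < ε := hLη

theorem exists_nhds_approx_idempotent {a : A} {P : Set (characterSpace ℂ A)} (hP : IsClopen P)
    {e : ∀ z, A ⧸ fiberIdeal a z} (hei : ∀ z, IsIdempotentElem (e z))
    (he : ∀ z (ψ : characterSpace ℂ (A ⧸ fiberIdeal a z)),
      (fiberPullback ψ ∈ P → ψ (e z) = 1) ∧ (fiberPullback ψ ∉ P → ψ (e z) = 0)) (z₀ : ℂ) :
    ∃ D ∈ 𝓝 z₀, ∀ ε > 0, ∃ b : A, ∀ z ∈ D,
      ‖Ideal.Quotient.mk (fiberIdeal a z) b - e z‖ < ε := by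
  obtain ⟨b, hb⟩ := Ideal.Quotient.mk_surjective (e z₀)
  have hs : ‖Ideal.Quotient.mk (fiberIdeal a z₀) (b ^ 2 - b)‖ < 1 / 16 := by
    rw [map_sub, map_pow, hb, sq, (hei z₀).eq, sub_self, norm_zero]
    norm_num
  obtain ⟨g, hg⟩ := exists_norm_sub_mul_lt hs
  have hD₁ : ∀ᶠ z in 𝓝 z₀, ‖(b ^ 2 - b) - (a - algebraMap ℂ A z) * g‖ < 1 / 16 := by
    refine Tendsto.eventually_lt_const hg ?_
    have h2 : Continuous fun z => ‖(b ^ 2 - b) - (a - algebraMapCLM ℂ A z) * g‖ := by fun_prop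
    exact h2.tendsto z₀
  set U : Set (characterSpace ℂ A) := (P ∩ {φ | ‖φ b - 1‖ < 1 / 32}) ∪ (Pᶜ ∩ {φ | ‖φ b‖ < 1 / 32})
  have hev : Continuous fun φ : characterSpace ℂ A => φ b :=
    (WeakDual.eval_continuous b).comp continuous_subtype_val
  have heva : Continuous fun φ : characterSpace ℂ A => φ a :=
    (WeakDual.eval_continuous a).comp continuous_subtype_val
  have hU : IsOpen U :=
    (hP.isOpen.inter (isOpen_lt (hev.sub continuous_const).norm continuous_const)).union
      (hP.compl.isOpen.inter (isOpen_lt hev.norm continuous_const))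
  have hD₂ : ((fun φ : characterSpace ℂ A => φ a) '' Uᶜ)ᶜ ∈ 𝓝 z₀ := by
    refine (hU.isClosed_compl.isCompact.image heva).isClosed.isOpen_compl.mem_nhds ?_
    rintro ⟨φ, hφ, hφa⟩
    obtain ⟨ψ, rfl⟩ := exists_fiberPullback_eq hφa
    refine hφ ?_
    by_cases h : fiberPullback ψ ∈ P
    · refine Or.inl ⟨h, ?_⟩
      rw [Set.mem_ofPred_eq, fiberPullback_apply, hb, (he z₀ ψ).1 h]
      norm_num
    · refine Or.inr ⟨h, ?_⟩
      rw [Set.mem_ofPred_eq, fiberPullback_apply, hb, (he z₀ ψ).2 h]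
      norm_num
  refine ⟨_, inter_mem hD₁ hD₂, fun ε hε => ?_⟩
  have hlim : Tendsto (fun m : ℕ => ‖b - algebraMap ℂ A (1 / 2)‖ *
      (2 * (‖(1 : A)‖ + 1) * (1 / 4) ^ m)) atTop (𝓝 0) := by
    have := tendsto_pow_atTop_nhds_zero_of_lt_one (r := (1 / 4 : ℝ)) (by norm_num) (by norm_num)
    simpa using (this.const_mul (2 * (‖(1 : A)‖ + 1))).const_mul ‖b - algebraMap ℂ A (1 / 2)‖
  obtain ⟨m, hm⟩ := (hlim.eventually_lt_const hε).exists
  refine ⟨idempotentApprox b m, fun z hz => ?_⟩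
  set π := Ideal.Quotient.mk (fiberIdeal a z) with hπ
  have hpow : ∀ k, ‖(π b ^ 2 - π b) ^ k‖ ≤ (‖(1 : A)‖ + 1) * (1 / 16) ^ k := fun k => by
    rcases Nat.eq_zero_or_pos k with rfl | hk
    · have : ‖(1 : A ⧸ fiberIdeal a z)‖ ≤ ‖(1 : A)‖ :=
        Ideal.Quotient.norm_mk_le (fiberIdeal a z) (1 : A)
      rw [pow_zero, pow_zero, mul_one]
      linarith
    · have h1 : ‖π b ^ 2 - π b‖ ≤ 1 / 16 := by
        have h2 := (norm_mk_fiberIdeal_le a z (b ^ 2 - b) g).trans_lt hz.1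
        rw [map_sub, map_pow] at h2
        exact h2.le
      calc ‖(π b ^ 2 - π b) ^ k‖ ≤ ‖π b ^ 2 - π b‖ ^ k := norm_pow_le' _ hk
        _ ≤ 1 * (1 / 16) ^ k := by rw [one_mul]; gcongr
        _ ≤ _ := by gcongr; linarith [norm_nonneg (1 : A)]
  obtain ⟨e', he'i, he'm, he'φ⟩ := exists_isIdempotentElem_near hpow
  have hee : e' = e z := he'i.eq_of_forall_apply_eq (hei z) fun ψ => by
    have hψ : fiberPullback ψ ∈ U := by
      by_contra h
      exact hz.2 ⟨_, h, fiberPullback_apply_self ψ⟩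
    rcases hψ with ⟨h, h'⟩ | ⟨h, h'⟩
    · rw [(he z ψ).1 h, (he'φ ψ).2 h'.le]
    · rw [(he z ψ).2 h, (he'φ ψ).1 h'.le]
  have hmap : π (idempotentApprox b m) = idempotentApprox (π b) m :=
    map_idempotentApprox (Ideal.Quotient.mkₐ ℂ (fiberIdeal a z)) b m
  rw [← hee, hmap, norm_sub_rev]
  refine (he'm m).trans_lt (lt_of_le_of_lt ?_ hm)
  gcongr
  exact Ideal.Quotient.norm_mk_le (fiberIdeal a z) (b - algebraMap ℂ A (1 / 2))

end Fiber

universe u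

theorem exists_isIdempotentElem_of_separating {n : ℕ} :
    ∀ {A : Type u} [NormedCommRing A] [NormedAlgebra ℂ A] [CompleteSpace A] (v : Fin n → A)
      {P : Set (characterSpace ℂ A)}, IsClopen P →
      (∀ φ ∈ P, ∀ ψ ∉ P, ∃ i, φ (v i) ≠ ψ (v i)) →
      ∃ e : A, IsIdempotentElem e ∧
        ∀ φ : characterSpace ℂ A, (φ ∈ P → φ e = 1) ∧ (φ ∉ P → φ e = 0) := by
  induction n with
  | zero =>
    intro A _ _ _ v P hP hv
    rcases P.eq_empty_or_nonempty with rfl | ⟨φ, hφ⟩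
    · exact ⟨0, IsIdempotentElem.zero, fun φ => ⟨fun h => h.elim, fun _ => map_zero φ⟩⟩
    · refine ⟨1, IsIdempotentElem.one, fun ψ => ⟨fun _ => map_one ψ, fun hψ => ?_⟩⟩
      obtain ⟨i, -⟩ := hv φ hφ ψ hψ
      exact i.elim0
  | succ n ih =>
    intro A _ _ _ v P hP hv
    have hq : ∀ z, ∃ e : A ⧸ fiberIdeal (v 0) z, IsIdempotentElem e ∧
        ∀ ψ : characterSpace ℂ (A ⧸ fiberIdeal (v 0) z),
          (fiberPullback ψ ∈ P → ψ e = 1) ∧ (fiberPullback ψ ∉ P → ψ e = 0) := fun z =>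
      ih (fun i => Ideal.Quotient.mk (fiberIdeal (v 0) z) (v i.succ))
        (hP.preimage continuous_fiberPullback) fun φ hφ ψ hψ => by
          obtain ⟨i, hi⟩ := hv _ hφ _ hψ
          cases i using Fin.cases with
          | zero => exact absurd (by simp [fiberPullback_apply_self]) hi
          | succ i => exact ⟨i, hi⟩
    choose e hei he using hq
    classical
    set f : characterSpace ℂ A → ℂ := fun φ => if φ ∈ P then 1 else 0 with hf
    obtain ⟨b, hb⟩ := exists_norm_apply_sub_lt (f := f)
      (fun z ψ => by
        by_cases h : fiberPullback ψ ∈ P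
        · simp [hf, h, (he z ψ).1 h]
        · simp [hf, h, (he z ψ).2 h])
      (exists_nhds_approx_idempotent hP hei he) (ε := 1 / 32) (by norm_num)
    obtain ⟨C, hC⟩ := exists_forall_norm_pow_le (s := b ^ 2 - b) (r := 1 / 16) (by norm_num)
      fun φ => by
        have h1 : φ (b ^ 2 - b) = (φ b - f φ) * (φ b - f φ + (2 * f φ - 1)) := by
          have : f φ * f φ = f φ := by simp [hf]
          rw [map_sub, map_pow]
          linear_combination this
        have h2 : ‖2 * f φ - 1‖ = 1 := by
          by_cases h : φ ∈ P
          · simp only [hf, h, if_true]; norm_num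
          · simp [hf, h]
        rw [h1, norm_mul]
        have h3 : ‖φ b - f φ + (2 * f φ - 1)‖ ≤ 1 / 32 + 1 :=
          (norm_add_le _ _).trans (add_le_add (hb φ).le h2.le)
        calc _ ≤ 1 / 32 * (1 / 32 + 1 : ℝ) := by
              gcongr
              exact (hb φ).le
          _ < _ := by norm_num
    obtain ⟨e', he'i, -, he'⟩ := exists_isIdempotentElem_near hC
    refine ⟨e', he'i, fun φ => ⟨fun h => (he' φ).2 ?_, fun h => (he' φ).1 ?_⟩⟩
    · simpa [hf, h] using (hb φ).le
    · simpa [hf, h] using (hb φ).le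

/-- The **Shilov idempotent theorem**. -/
theorem exists_isIdempotentElem_of_isClopen {A : Type u} [NormedCommRing A] [NormedAlgebra ℂ A]
    [CompleteSpace A] {P : Set (characterSpace ℂ A)} (hP : IsClopen P) :
    ∃ e : A, IsIdempotentElem e ∧
      ∀ φ : characterSpace ℂ A, (φ ∈ P → φ e = 1) ∧ (φ ∉ P → φ e = 0) := by
  have hev : ∀ x : A, Continuous fun φ : characterSpace ℂ A => φ x := fun x =>
    (WeakDual.eval_continuous x).comp continuous_subtype_val
  obtain ⟨t, ht⟩ := (hP.isClosed.isCompact.prod hP.compl.isClosed.isCompact).elim_finite_subcover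
    (fun x : A => {p : characterSpace ℂ A × characterSpace ℂ A | p.1 x ≠ p.2 x})
    (fun x => isOpen_ne_fun ((hev x).comp continuous_fst) ((hev x).comp continuous_snd))
    (by
      rintro ⟨φ, ψ⟩ ⟨hφ, hψ⟩
      rw [Set.mem_iUnion]
      by_contra! h
      have : φ = ψ := by
        ext x
        by_contra hx
        exact h x hx
      exact hψ (this ▸ hφ))
  refine exists_isIdempotentElem_of_separating (fun i => (t.equivFin.symm i : A)) hP
    fun φ hφ ψ hψ => ?_
  have := ht (Set.mk_mem_prod hφ hψ)
  simp only [Set.mem_iUnion] at this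
  obtain ⟨x, hx, hne⟩ := this
  exact ⟨t.equivFin ⟨x, hx⟩, by simpa using hne⟩

theorem unbounded_connectedComponentIn_of_ray {B : Type*} [Ring B] [Algebra ℂ B] {M : B} {u : ℂ}
    (hu : u ≠ 0) (h : ∀ t : ℝ, 0 ≤ t → (t * u : ℂ) ∉ spectrum ℂ M) :
    IsUnit M ∧ (0 : ℂ) ∉ spectrum ℂ M ∧
      ¬ Bornology.IsBounded (connectedComponentIn (spectrum ℂ M)ᶜ 0) := by
  have h0 : (0 : ℂ) ∉ spectrum ℂ M := by simpa using h 0 le_rfl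
  refine ⟨(spectrum.zero_notMem_iff ℂ).mp h0, h0, fun hb => ?_⟩
  have hsub : (fun t : ℝ => (t * u : ℂ)) '' Set.Ici 0 ⊆
      connectedComponentIn (spectrum ℂ M)ᶜ 0 := by
    refine IsPreconnected.subset_connectedComponentIn ?_ ⟨0, Set.self_mem_Ici, by simp⟩ ?_
    · exact isPreconnected_Ici.image _ (by fun_prop)
    · rintro _ ⟨t, ht, rfl⟩
      exact h t ht
  obtain ⟨R, hR⟩ := (hb.subset hsub).exists_norm_le
  have hu' : 0 < ‖u‖ := norm_pos_iff.mpr hu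
  have h1 := hR _ ⟨(|R| + 1) / ‖u‖, Set.mem_Ici.mpr (by positivity), rfl⟩
  rw [norm_mul, Complex.norm_real, Real.norm_of_nonneg (by positivity),
    div_mul_cancel₀ _ hu'.ne'] at h1
  linarith [le_abs_self R]

section Matrix

variable {n : ℕ}

theorem exists_ray_det_ne_zero {B : Matrix (Fin n) (Fin n) ℂ} (hB : B.det ≠ 0) :
    ∃ u : ℂ, u ≠ 0 ∧ (∀ t : ℝ, 0 ≤ t → (t * u : ℂ) ≠ 1) ∧
      ∀ t : ℝ, 0 ≤ t → (algebraMap ℂ _ (t * u : ℂ) - B).det ≠ 0 := by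
  obtain ⟨s, hs⟩ := Infinite.exists_notMem_finset
    (B.charpoly.roots.toFinset.image fun r => -(r.im / r.re))
  refine ⟨⟨-1, s⟩, fun h => ?_, fun t ht h => ?_, fun t ht h => ?_⟩
  · simpa using congrArg Complex.re h
  · have := congrArg Complex.re h
    simp at this
    linarith
  · have hroot : (t * ⟨-1, s⟩ : ℂ) ∈ B.charpoly.roots.toFinset := by
      rw [Multiset.mem_toFinset, Polynomial.mem_roots B.charpoly_monic.ne_zero,
        Polynomial.IsRoot, Matrix.eval_charpoly]
      exact h
    rcases eq_or_ne t 0 with rfl | ht0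
    · refine hB ?_
      have h1 : (-B).det = 0 := by simpa using h
      rw [Matrix.det_neg] at h1
      exact (mul_eq_zero.mp h1).resolve_left (by simp)
    · refine hs (Finset.mem_image.mpr ⟨_, hroot, ?_⟩)
      simp
      field_simp

variable {A : Type*} [NormedCommRing A] [NormedAlgebra ℂ A]

theorem isOpen_setOf_forall_ray_det_ne_zero (M : Matrix (Fin n) (Fin n) A) {u : ℂ} (hu : u ≠ 0) :
    IsOpen {ψ : characterSpace ℂ A | ∀ t : ℝ, 0 ≤ t →
      (algebraMap ℂ _ (t * u : ℂ) - (CharacterSpace.toAlgHom ψ).mapMatrix M).det ≠ 0} := by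
  set G : characterSpace ℂ A × ℝ → ℂ := fun p =>
    (((p.2 : ℂ) * u) • (1 : Matrix (Fin n) (Fin n) ℂ) -
      (1 - p.2 : ℂ) • (CharacterSpace.toAlgHom p.1).mapMatrix M).det with hG
  have hGc : Continuous G := by
    have hm : Continuous fun ψ : characterSpace ℂ A =>
        (CharacterSpace.toAlgHom ψ).mapMatrix M :=
      continuous_matrix fun i j => (WeakDual.eval_continuous (M i j)).comp continuous_subtype_val
    have hm' : Continuous fun p : characterSpace ℂ A × ℝ =>
        (CharacterSpace.toAlgHom p.1).mapMatrix M := hm.comp continuous_fst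
    refine Continuous.matrix_det (Continuous.sub (by fun_prop) (Continuous.fun_smul ?_ hm'))
    fun_prop
  have hscale : ∀ ψ (t : ℝ), 0 ≤ t → G (ψ, t / (1 + t)) = (1 / (1 + t) : ℂ) ^ n *
      (algebraMap ℂ _ (t * u : ℂ) - (CharacterSpace.toAlgHom ψ).mapMatrix M).det := by
    intro ψ t ht
    have ht1 : (1 + t : ℂ) ≠ 0 := by exact_mod_cast (by positivity : (1 + t : ℝ) ≠ 0)
    have h1 : (1 - (t / (1 + t) : ℝ) : ℂ) = 1 / (1 + t) := by
      push_cast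
      field_simp
      ring
    have h2 : ((t / (1 + t) : ℝ) * u : ℂ) = 1 / (1 + t) * (t * u) := by
      push_cast
      field_simp
    have h3 := Matrix.det_smul
      (algebraMap ℂ _ (t * u : ℂ) - (CharacterSpace.toAlgHom ψ).mapMatrix M) (1 / (1 + t) : ℂ)
    rw [Fintype.card_fin] at h3
    rw [← h3, hG]
    simp only
    rw [h1, h2, smul_sub, Algebra.algebraMap_eq_smul_one, smul_smul]
  have hset : {ψ : characterSpace ℂ A | ∀ t : ℝ, 0 ≤ t →
      (algebraMap ℂ _ (t * u : ℂ) - (CharacterSpace.toAlgHom ψ).mapMatrix M).det ≠ 0} =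
      {ψ | ∀ s ∈ Set.Icc (0 : ℝ) 1, G (ψ, s) ≠ 0} := by
    ext ψ
    constructor
    · rintro h s ⟨hs0, hs1⟩
      rcases eq_or_lt_of_le hs1 with rfl | hs1
      · simp [hG, hu]
      · have hs2 : 0 < 1 - s := by linarith
        have h1 := hscale ψ (s / (1 - s)) (by positivity)
        have h2 : s / (1 - s) / (1 + s / (1 - s)) = s := by
          field_simp
          ring
        rw [h2] at h1
        rw [h1]
        refine mul_ne_zero (pow_ne_zero _ (one_div_ne_zero ?_)) (h _ (by positivity))
        exact_mod_cast (by positivity : (1 + s / (1 - s) : ℝ) ≠ 0)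
    · intro h t ht
      refine right_ne_zero_of_mul (a := (1 / (1 + t) : ℂ) ^ n) ?_
      rw [← hscale ψ t ht]
      exact h _ ⟨by positivity, (div_le_one (by positivity)).mpr (by linarith)⟩
  rw [hset, isOpen_iff_eventually]
  intro ψ hψ
  refine isCompact_Icc.eventually_forall_of_forall_eventually fun s hs => ?_
  exact (isOpen_ne_fun hGc continuous_const).mem_nhds (hψ s hs)

variable [CompleteSpace A]

theorem notMem_spectrum_idempotent_smul {M : Matrix (Fin n) (Fin n) A} {e : A} {z : ℂ} (hz : z ≠ 1)
    (h : ∀ ψ : characterSpace ℂ A, ψ e = 0 ∨ ψ e = 1 ∧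
      (algebraMap ℂ _ z - (CharacterSpace.toAlgHom ψ).mapMatrix M).det ≠ 0) :
    z ∉ spectrum ℂ (e • (M - 1) + 1) := by
  rw [spectrum.notMem_iff, Matrix.isUnit_iff_isUnit_det]
  refine isUnit_of_forall_apply_ne_zero fun ψ => ?_
  have h1 : ψ (algebraMap ℂ (Matrix (Fin n) (Fin n) A) z - (e • (M - 1) + 1)).det =
      (algebraMap ℂ (Matrix (Fin n) (Fin n) ℂ) z -
        (ψ e • ((CharacterSpace.toAlgHom ψ).mapMatrix M - 1) + 1)).det := by
    refine (AlgHom.map_det (CharacterSpace.toAlgHom ψ) _).trans ?_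
    rw [map_sub, AlgHom.commutes, map_add, map_one]
    congr 3
    rw [← map_one (CharacterSpace.toAlgHom ψ).mapMatrix, ← map_sub]
    ext i j
    exact map_mul ψ _ _
  rw [h1]
  rcases h ψ with h0 | ⟨h0, h2⟩
  · rw [h0, zero_smul, zero_add, ← map_one (algebraMap ℂ (Matrix (Fin n) (Fin n) ℂ)), ← map_sub,
      Algebra.algebraMap_eq_smul_one, Matrix.det_smul, Matrix.det_one, mul_one]
    exact pow_ne_zero _ (sub_ne_zero.mpr hz)
  · rwa [h0, one_smul, sub_add_cancel]

end Matrix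

theorem exists_idempotent_partition_of_isClopen_cover {A : Type u} [NormedCommRing A]
    [NormedAlgebra ℂ A] [CompleteSpace A] {k : ℕ} {W : Fin k → Set (characterSpace ℂ A)}
    (hW : ∀ i, IsClopen (W i)) (hcov : ∀ φ, ∃ i, φ ∈ W i) :
    ∃ e : Fin k → A, (∀ i, IsIdempotentElem (e i)) ∧ ∑ i, e i = 1 ∧
      (∀ i j, i ≠ j → e i * e j = 0) ∧
      ∀ (φ : characterSpace ℂ A) i, φ (e i) = 0 ∨ φ (e i) = 1 ∧ φ ∈ W i := by
  set P : Fin k → Set (characterSpace ℂ A) := fun i => W i \ ⋃ j ∈ Set.Iio i, W j with hP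
  have hPc : ∀ i, IsClopen (P i) := fun i =>
    (hW i).diff ((Set.toFinite _).isClopen_biUnion fun j _ => hW j)
  have hdisj : ∀ i j, i ≠ j → ∀ φ ∈ P i, φ ∉ P j := fun i j hij φ hi hj => by
    rcases lt_or_gt_of_ne hij with h | h
    · exact hj.2 (Set.mem_biUnion h hi.1)
    · exact hi.2 (Set.mem_biUnion h hj.1)
  have hex : ∀ φ, ∃ i, φ ∈ P i := fun φ => by
    obtain ⟨i, hi, hmin⟩ := WellFounded.has_min (wellFounded_lt (α := Fin k)) {i | φ ∈ W i}
      (hcov φ)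
    refine ⟨i, hi, fun h => ?_⟩
    simp only [Set.mem_iUnion] at h
    obtain ⟨j, hj, hφj⟩ := h
    exact hmin j hφj hj
  choose e hei he using fun i => exists_isIdempotentElem_of_isClopen (hPc i)
  have horth : ∀ i j, i ≠ j → e i * e j = 0 := fun i j hij =>
    ((hei i).mul (hei j)).eq_of_forall_apply_eq IsIdempotentElem.zero fun φ => by
      rw [map_mul, map_zero]
      by_cases h : φ ∈ P i
      · rw [(he j φ).2 (hdisj i j hij φ h), mul_zero]
      · rw [(he i φ).2 h, zero_mul]
  refine ⟨e, hei, ?_, horth, fun φ i => ?_⟩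
  · refine (OrthogonalIdempotents.isIdempotentElem_sum ⟨hei, fun i j => horth i j⟩
      ).eq_of_forall_apply_eq IsIdempotentElem.one fun φ => ?_
    obtain ⟨i, hi⟩ := hex φ
    rw [map_sum, map_one, Finset.sum_eq_single i
      (fun j _ hj => (he j φ).2 (hdisj i j hj.symm φ hi)) (by simp), (he i φ).1 hi]
  · by_cases h : φ ∈ P i
    · exact Or.inr ⟨(he i φ).1 h, h.1⟩
    · exact Or.inl ((he i φ).2 h)

end IdempotentPartition

/-- **Lemma 2.2.** Let `𝒜` be a commutative unital complex Banach algebra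
whose character space is totally disconnected and let `A ∈ GL_n(𝒜)`. Then there are finitely
many idempotents `e₁, …, e_k ∈ 𝒜` summing to `1` with `eᵢeⱼ = 0` for `i ≠ j`, such that each
matrix `Aᵢ = eᵢ·(A − Iₙ) + Iₙ` is invertible and `0` lies in the unbounded connected
component of the complement of the spectrum `σ(Aᵢ) ⊆ ℂ`. -/
theorem exists_idempotent_partition_spectrum
    {𝒜 : Type*} [NormedCommRing 𝒜] [NormedAlgebra ℂ 𝒜] [CompleteSpace 𝒜]
    (hM : TotallyDisconnectedSpace (WeakDual.characterSpace ℂ 𝒜))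
    (n : ℕ) (A : Matrix (Fin n) (Fin n) 𝒜) (hA : IsUnit A) :
    ∃ (k : ℕ) (e : Fin k → 𝒜),
      (∀ i, IsIdempotentElem (e i)) ∧
      (∑ i, e i = 1) ∧
      (∀ i j, i ≠ j → e i * e j = 0) ∧
      (∀ i, IsUnit (e i • (A - 1) + 1) ∧
        (0 : ℂ) ∉ spectrum ℂ (e i • (A - 1) + 1) ∧
        ¬ Bornology.IsBounded
          (connectedComponentIn (spectrum ℂ (e i • (A - 1) + 1))ᶜ 0)) := by
  have hray : ∀ φ : WeakDual.characterSpace ℂ 𝒜, ∃ u : ℂ, u ≠ 0 ∧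
      (∀ t : ℝ, 0 ≤ t → (t * u : ℂ) ≠ 1) ∧ ∀ t : ℝ, 0 ≤ t → (algebraMap ℂ _ (t * u : ℂ) -
        (WeakDual.CharacterSpace.toAlgHom φ).mapMatrix A).det ≠ 0 := fun φ => by
    have hu := hA.map (WeakDual.CharacterSpace.toAlgHom φ).mapMatrix
    rw [Matrix.isUnit_iff_isUnit_det] at hu
    exact exists_ray_det_ne_zero hu.ne_zero
  choose u hu hu1 hdet using hray
  choose W hWc hWmem hWsub using fun φ => compact_exists_isClopen_in_isOpen
    (isOpen_setOf_forall_ray_det_ne_zero A (hu φ)) (hdet φ)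
  obtain ⟨t, -, ht⟩ := isCompact_univ.elim_nhds_subcover W
    fun φ _ => (hWc φ).isOpen.mem_nhds (hWmem φ)
  obtain ⟨e, hei, hsum, horth, he⟩ := exists_idempotent_partition_of_isClopen_cover
    (W := fun i => W (t.equivFin.symm i)) (fun i => hWc _) (fun φ => by
      obtain ⟨ψ, hψ, hφ⟩ := Set.mem_iUnion₂.mp (ht (Set.mem_univ φ))
      exact ⟨t.equivFin ⟨ψ, hψ⟩, by simpa using hφ⟩)
  refine ⟨_, e, hei, hsum, horth, fun i =>
    unbounded_connectedComponentIn_of_ray (hu (t.equivFin.symm i)) fun r hr =>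
      notMem_spectrum_idempotent_smul (hu1 _ r hr) fun ψ => ?_⟩
  exact (he ψ i).imp id fun h => ⟨h.1, hWsub _ h.2 r hr⟩
end
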